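/- Suppose f ∈ F_q[x] has degree D > 1 and is not of the form a·x^D (a ∈ F_q) nor of the form a·x^{p^h} + b (a, b ∈ F_q, h ≥ 0). Let d > 1 be the degree of the p-reduction of f. For n ≥ 0 let Δ_n(f) be the degree of the squarefree part of f^{(n)}, D_n(f) the largest degree of an irreducible factor of f^{(n)} over F_q, and r_n(f) the number of distinct irreducible factors of f^{(n)} over F_q. Then: (i) there exist real constants c₁, c₂ > 0 with c₁·d^n ≤ Δ_n(f) ≤ c₂·d^n for all n; (ii) there exists c > 0 with D_n(f) ≥ c·n for all n; (iii) there exists C > 0 such that for every n ≥ 0, either r_n(f) ≥ C·d^{n/2} or D_n(f) ≥ C·d^{n/2}. -/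

import Mathlib

open Polynomial UniqueFactorizationMonoid
open scoped Classical

/-- The `n`-th compositional iterate of a polynomial `g`. -/
noncomputable def iterPoly {K : Type*} [CommSemiring K] (g : Polynomial K) : ℕ → Polynomial K
  | 0 => X
  | n + 1 => g.comp (iterPoly g n)

/-- `P_n[f,g] = f(g^{(n)})`. -/
noncomputable def Pn {K : Type*} [CommSemiring K] (f g : Polynomial K) (n : ℕ) : Polynomial K :=
  f.comp (iterPoly g n)

/-- The finset of (normalized) monic irreducible factors of `P`. -/
noncomputable def irrFactors {K : Type*} [Field K] (P : Polynomial K) : Finset (Polynomial K) :=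
  (normalizedFactors P).toFinset

/-- Number of distinct irreducible factors of `P`. -/
noncomputable def Nfac {K : Type*} [Field K] (P : Polynomial K) : ℕ := (irrFactors P).card

/-- Degree of the squarefree part of `P`. -/
noncomputable def Dfac {K : Type*} [Field K] (P : Polynomial K) : ℕ :=
  ∑ r ∈ irrFactors P, r.natDegree

/-- Largest degree of an irreducible factor of `P`. -/
noncomputable def Mfac {K : Type*} [Field K] (P : Polynomial K) : ℕ :=
  (irrFactors P).sup natDegree

/-- Smallest degree of an irreducible factor of `P`. -/
noncomputable def mfac {K : Type*} [Field K] (P : Polynomial K) : ℕ :=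
  sInf {d | ∃ r ∈ irrFactors P, r.natDegree = d}

/-- Largest multiplicity in the irreducible factorization of `P`. -/
noncomputable def Efac {K : Type*} [Field K] (P : Polynomial K) : ℕ :=
  (irrFactors P).sup fun r => (normalizedFactors P).count r

/-- Smallest multiplicity in the irreducible factorization of `P`. -/
noncomputable def efac {K : Type*} [Field K] (P : Polynomial K) : ℕ :=
  sInf {e | ∃ r ∈ irrFactors P, (normalizedFactors P).count r = e}

/-- Largest multiplicity of a root of `P` in an algebraic closure. -/
noncomputable def nuMax {K : Type*} [Field K] (P : Polynomial K) : ℕ :=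
  Efac (P.map (algebraMap K (AlgebraicClosure K)))

/-- Smallest multiplicity of a root of `P` in an algebraic closure. -/
noncomputable def nuMin {K : Type*} [Field K] (P : Polynomial K) : ℕ :=
  efac (P.map (algebraMap K (AlgebraicClosure K)))

/-- The pair `(f, g)` is `p`-critical: `g = a x^{p^h} + b`. -/
def IsPCritical {K : Type*} [Field K] (p : ℕ) (_f g : Polynomial K) : Prop :=
  ∃ (h : ℕ) (a b : K), g = C a * X ^ p ^ h + C b

/-- The pair `(f, g)` is critical: `f = β (x-α)^{deg f}` and `g = γ (x-α)^{deg g} + α`. -/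
def IsCritical {K : Type*} [Field K] (f g : Polynomial K) : Prop :=
  ∃ α β γ : K, f = C β * (X - C α) ^ f.natDegree ∧
    g = C γ * (X - C α) ^ g.natDegree + C α
section FactorCounting

variable {K : Type*} [Field K]

lemma mem_irrFactors {P r : K[X]} (hP : P ≠ 0) :
    r ∈ irrFactors P ↔ r.Monic ∧ Irreducible r ∧ r ∣ P := by
  rw [irrFactors, Multiset.mem_toFinset, Polynomial.mem_normalizedFactors_iff hP]
  tauto

/-- Over a perfect field, the degree of the squarefree part is the number of distinct roots in an
algebraic closure. -/
lemma Dfac_eq_card_aroots [PerfectField K] {P : K[X]} (hP : P ≠ 0) :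
    Dfac P = (P.aroots (AlgebraicClosure K)).toFinset.card := by
  have hmem := fun r (hr : r ∈ irrFactors P) => (mem_irrFactors hP).1 hr
  set R : K[X] := ∏ r ∈ irrFactors P, r with hR
  have hsep : R.Separable := by
    refine separable_prod' ?_ fun r hr =>
      PerfectField.separable_of_irreducible (hmem r hr).2.1
    intro r hr s hs hrs
    refine ((hmem r hr).2.1.coprime_iff_not_dvd.2 fun hdvd => hrs ?_)
    exact eq_of_monic_of_associated (hmem r hr).1 (hmem s hs).1
      ((hmem r hr).2.1.associated_of_dvd (hmem s hs).2.1 hdvd)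
  have hR0 : R ≠ 0 := hsep.ne_zero
  have hdeg : R.natDegree = Dfac P := natDegree_prod_of_monic _ _ fun r hr => (hmem r hr).1
  have hroots : (P.aroots (AlgebraicClosure K)).toFinset =
      (R.aroots (AlgebraicClosure K)).toFinset := by
    ext x
    simp only [Multiset.mem_toFinset, mem_aroots, ne_eq, hP, hR0, not_false_eq_true, true_and]
    rw [hR, map_prod, Finset.prod_eq_zero_iff]
    constructor
    · intro hx
      have hassoc := (prod_normalizedFactors hP).symm
      have h0 : aeval x (normalizedFactors P).prod = 0 :=
        aeval_eq_zero_of_dvd_aeval_eq_zero hassoc.dvd hx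
      rw [map_multiset_prod, Multiset.prod_eq_zero_iff] at h0
      obtain ⟨r, hr, hr0⟩ := Multiset.mem_map.1 h0
      exact ⟨r, Multiset.mem_toFinset.2 hr, hr0⟩
    · rintro ⟨r, hr, hr0⟩
      exact aeval_eq_zero_of_dvd_aeval_eq_zero (hmem r hr).2.2 hr0
  rw [hroots, ← hdeg, Multiset.toFinset_card_of_nodup
    (nodup_roots (hsep.map (f := algebraMap K (AlgebraicClosure K)))),
    ← (IsAlgClosed.splits _).natDegree_eq_card_roots, natDegree_map]

lemma Dfac_le_Nfac_mul_Mfac (P : K[X]) : Dfac P ≤ Nfac P * Mfac P := by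
  simpa [Nfac, Dfac] using Finset.sum_le_card_nsmul (irrFactors P) natDegree (Mfac P)
    fun r hr => Finset.le_sup (f := natDegree) hr

lemma Nfac_le_pow_Mfac [Fintype K] (P : K[X]) :
    Nfac P ≤ Fintype.card K ^ (Mfac P + 1) := by
  have hinj : Set.InjOn (fun (r : K[X]) (i : Fin (Mfac P + 1)) => r.coeff i)
      (irrFactors P : Set K[X]) := by
    intro r hr s hs hrs
    have hr' : r.natDegree ≤ Mfac P := Finset.le_sup (f := natDegree) hr
    have hs' : s.natDegree ≤ Mfac P := Finset.le_sup (f := natDegree) hs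
    ext i
    by_cases hi : i < Mfac P + 1
    · exact congrFun hrs ⟨i, hi⟩
    · rw [coeff_eq_zero_of_natDegree_lt (by omega), coeff_eq_zero_of_natDegree_lt (by omega)]
  have := Finset.card_le_card_of_injOn (t := Finset.univ) _ (fun _ _ => Finset.mem_univ _) hinj
  simpa [Nfac] using this

end FactorCounting

section Preimages

variable {L : Type*} [Field L]

/-- The Riemann–Hurwitz count: the fibres of `G` over `B` have `G.natDegree * B.card` points up to
the zeros of the derivative. -/
lemma natDegree_mul_card_le_card_preimage [IsAlgClosed L] {G : L[X]} (hG : derivative G ≠ 0) {A B : Finset L}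
    (hAB : ∀ x, x ∈ A ↔ G.eval x ∈ B) :
    G.natDegree * B.card ≤ A.card + ∑ x ∈ A, (derivative G).rootMultiplicity x := by
  have hne (b : L) : G - C b ≠ 0 := fun h0 => hG (by
    rw [sub_eq_zero.1 h0, derivative_C])
  have hfib (b : L) (hb : b ∈ B) :
      A.filter (fun x => G.eval x = b) = (G - C b).roots.toFinset := by
    ext x
    simp only [Finset.mem_filter, Multiset.mem_toFinset, mem_roots (hne b), IsRoot.def, eval_sub,
      eval_C, sub_eq_zero, hAB]
    exact ⟨fun hx => hx.2, fun hx => ⟨hx ▸ hb, hx⟩⟩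
  have hbound (b : L) (hb : b ∈ B) : G.natDegree ≤
      ∑ x ∈ A with G.eval x = b, (1 + (derivative G).rootMultiplicity x) := by
    rw [hfib b hb, ← natDegree_sub_C (a := b),
      (IsAlgClosed.splits (G - C b)).natDegree_eq_card_roots, ← Multiset.toFinset_sum_count_eq]
    refine Finset.sum_le_sum fun x _ => ?_
    have := rootMultiplicity_sub_one_le_derivative_rootMultiplicity_of_ne_zero (G - C b) x
      (by simpa using hG)
    rw [derivative_sub, derivative_C, sub_zero] at this
    rw [count_roots]
    omega
  calc G.natDegree * B.card = ∑ b ∈ B, G.natDegree := by simp [mul_comm]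
    _ ≤ ∑ b ∈ B, ∑ x ∈ A with G.eval x = b, (1 + (derivative G).rootMultiplicity x) :=
        Finset.sum_le_sum hbound
    _ = ∑ x ∈ A, (1 + (derivative G).rootMultiplicity x) :=
        Finset.sum_fiberwise_of_maps_to (fun x hx => (hAB x).1 hx) _
    _ = _ := by simp [Finset.sum_add_distrib]

lemma card_preimage_le {G : L[X]} (hG : derivative G ≠ 0) {A B : Finset L}
    (hAB : ∀ x, x ∈ A ↔ G.eval x ∈ B) : A.card ≤ G.natDegree * B.card := by
  refine Finset.card_le_mul_card_image_of_maps_to (f := fun x => G.eval x)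
    (fun x hx => (hAB x).1 hx) _ fun b _ => ?_
  have hne : G - C b ≠ 0 := fun h0 => hG (by rw [sub_eq_zero.1 h0, derivative_C])
  calc _ ≤ (G - C b).roots.toFinset.card := Finset.card_le_card fun x hx => by
        rw [Multiset.mem_toFinset, mem_roots hne, IsRoot.def, eval_sub, eval_C, sub_eq_zero]
        exact (Finset.mem_filter.1 hx).2
    _ ≤ (G - C b).roots.card := Multiset.toFinset_card_le _
    _ ≤ (G - C b).natDegree := card_roots' _
    _ = G.natDegree := natDegree_sub_C

lemma sum_rootMultiplicity_derivative_le (G : L[X]) (A : Finset L) :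
    ∑ x ∈ A, (derivative G).rootMultiplicity x ≤ G.natDegree - 1 := by
  calc _ = ∑ x ∈ A, (derivative G).roots.count x := by simp
    _ ≤ ∑ x ∈ A ∪ (derivative G).roots.toFinset, (derivative G).roots.count x :=
        Finset.sum_le_sum_of_subset Finset.subset_union_left
    _ = (derivative G).roots.card := Multiset.sum_count_eq_card fun x hx =>
        Finset.mem_union_right _ (Multiset.mem_toFinset.2 hx)
    _ ≤ (derivative G).natDegree := card_roots' _
    _ ≤ _ := natDegree_derivative_le G

end Preimages

section Iterates

variable {K : Type*} [Field K]

lemma natDegree_iterPoly (f : K[X]) (n : ℕ) : (iterPoly f n).natDegree = f.natDegree ^ n := by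
  induction n with
  | zero => simp [iterPoly]
  | succ n ih => rw [iterPoly, natDegree_comp, ih, pow_succ']

lemma iterPoly_ne_zero {f : K[X]} (hf : 0 < f.natDegree) (n : ℕ) : iterPoly f n ≠ 0 :=
  ne_zero_of_natDegree_gt (n := 0) (by rw [natDegree_iterPoly]; positivity)

lemma aeval_iterPoly {L : Type*} [Field L] [Algebra K L] (f : K[X]) (n : ℕ) (x : L) :
    aeval x (iterPoly f n) = (fun y => aeval y f)^[n] x := by
  induction n with
  | zero => simp [iterPoly]
  | succ n ih => rw [iterPoly, aeval_comp, ih, Function.iterate_succ_apply']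

lemma exists_eq_C_mul_X_pow_of_aroots {L : Type*} [Field L] [IsAlgClosed L] [Algebra K L]
    {G : K[X]} (hG : ∀ x ∈ G.aroots L, x = 0) : ∃ c : K, G = C c * X ^ G.natDegree := by
  have hroots : (G.map (algebraMap K L)).roots = Multiset.replicate G.natDegree 0 := by
    rw [Multiset.eq_replicate, ← (IsAlgClosed.splits _).natDegree_eq_card_roots, natDegree_map]
    exact ⟨rfl, hG⟩
  have hmap := (IsAlgClosed.splits (G.map (algebraMap K L))).eq_prod_roots
  rw [hroots] at hmap
  refine ⟨G.leadingCoeff, map_injective _ (algebraMap K L).injective ?_⟩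
  rw [hmap]
  simp

variable {p : ℕ} [Fact p.Prime] [CharP K p]

lemma card_aroots_iterPoly_bounds {f G : K[X]} {h : ℕ} (hred : f = G ^ p ^ h)
    (hG : derivative G ≠ 0) (hf : 0 < f.natDegree) (n : ℕ) :
    ((iterPoly f (n + 1)).aroots (AlgebraicClosure K)).toFinset.card ≤
        G.natDegree * ((iterPoly f n).aroots (AlgebraicClosure K)).toFinset.card ∧
      G.natDegree * ((iterPoly f n).aroots (AlgebraicClosure K)).toFinset.card ≤
        ((iterPoly f (n + 1)).aroots (AlgebraicClosure K)).toFinset.card +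
        ∑ x ∈ ((iterPoly f (n + 1)).aroots (AlgebraicClosure K)).toFinset,
          (derivative (G.map (algebraMap K (AlgebraicClosure K)))).rootMultiplicity x := by
  have : CharP (AlgebraicClosure K) p := charP_of_injective_algebraMap' K p
  set L := AlgebraicClosure K
  set e := iterateFrobeniusEquiv L p h
  set A := ((iterPoly f (n + 1)).aroots L).toFinset
  set S := ((iterPoly f n).aroots L).toFinset
  have hG' : derivative (G.map (algebraMap K L)) ≠ 0 := by
    rwa [derivative_map, Polynomial.map_ne_zero_iff (algebraMap K L).injective]
  have hAB : ∀ x, x ∈ A ↔ (G.map (algebraMap K L)).eval x ∈ S.image e.symm := by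
    intro x
    have h1 : (G.map (algebraMap K L)).eval x ∈ S.image e.symm ↔ aeval x f ∈ S := by
      have hx : aeval x f = e ((G.map (algebraMap K L)).eval x) := by
        rw [iterateFrobeniusEquiv_def, hred, map_pow, eval_map_algebraMap]
      rw [hx, Finset.mem_image]
      constructor
      · rintro ⟨y, hy, hyx⟩
        rwa [← hyx, e.apply_symm_apply]
      · exact fun hx => ⟨_, hx, e.symm_apply_apply _⟩
    rw [h1]
    simp only [A, S, Multiset.mem_toFinset, mem_aroots, ne_eq, iterPoly_ne_zero hf,
      not_false_eq_true, true_and, aeval_iterPoly, Function.iterate_succ_apply]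
  have hcard : (S.image e.symm).card = S.card := Finset.card_image_of_injective _ e.symm.injective
  have hu := card_preimage_le hG' hAB
  have hl := natDegree_mul_card_le_card_preimage hG' hAB
  rw [natDegree_map, hcard] at hu hl
  exact ⟨hu, hl⟩

lemma one_lt_card_aroots_iterPoly_two {f G : K[X]} {h : ℕ} (hred : f = G ^ p ^ h)
    (hG : derivative G ≠ 0) (hd : 1 < G.natDegree) (hf : 0 < f.natDegree)
    (hform : ¬ ∃ a : K, f = C a * X ^ f.natDegree) :
    1 < ((iterPoly f 2).aroots (AlgebraicClosure K)).toFinset.card := by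
  set L := AlgebraicClosure K
  set S : ℕ → Finset L := fun n => ((iterPoly f n).aroots L).toFinset with hS
  have hlow (n : ℕ) := (card_aroots_iterPoly_bounds hred hG hf n).2
  set μ : L → ℕ := fun x => (derivative (G.map (algebraMap K L))).rootMultiplicity x
  have hsum (A : Finset L) : ∑ x ∈ A, μ x ≤ G.natDegree - 1 := by
    simpa only [natDegree_map] using sum_rootMultiplicity_derivative_le (G.map (algebraMap K L)) A
  have hmem (n : ℕ) (x : L) : x ∈ S n ↔ (fun y => aeval y f)^[n] x = 0 := by
    simp only [hS, Multiset.mem_toFinset, mem_aroots, ne_eq, iterPoly_ne_zero hf,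
      not_false_eq_true, true_and, aeval_iterPoly]
  have h0 : (S 0).card = 1 := by
    rw [Finset.card_eq_one]
    exact ⟨0, by ext x; simp [hmem]⟩
  change 1 < (S 2).card
  have l0 : G.natDegree * (S 0).card ≤ (S 1).card + ∑ x ∈ S 1, μ x := hlow 0
  have l1 : G.natDegree * (S 1).card ≤ (S 2).card + ∑ x ∈ S 2, μ x := hlow 1
  have s1 := hsum (S 1)
  have s2 := hsum (S 2)
  rw [h0] at l0
  have hpos : 1 ≤ (S 1).card := by omega
  by_contra hcon
  have h1 : (S 1).card = 1 := by nlinarith [Nat.sub_add_cancel hd.le]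
  rw [h1] at l1
  have h2 : (S 2).card = 1 := by omega
  obtain ⟨a, ha⟩ := Finset.card_eq_one.1 h1
  obtain ⟨b, hb⟩ := Finset.card_eq_one.1 h2
  rw [ha, Finset.card_singleton, Finset.sum_singleton] at l0
  rw [hb, Finset.card_singleton, Finset.sum_singleton] at l1
  have hab : a = b := by
    by_contra hab
    have := hsum {a, b}
    rw [Finset.sum_pair hab] at this
    omega
  have haf : aeval a f = 0 := (hmem 1 a).1 (by rw [ha]; exact Finset.mem_singleton_self a)
  have hbf : aeval (aeval b f) f = 0 :=
    (hmem 2 b).1 (by rw [hb]; exact Finset.mem_singleton_self b)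
  have ha0 : a = 0 := by
    have : (0 : L) ∈ S 1 := (hmem 1 0).2 (by simpa [← hab, haf] using hbf)
    rw [ha] at this
    exact (Finset.mem_singleton.1 this).symm
  refine hform (exists_eq_C_mul_X_pow_of_aroots (L := L) fun x hx => ?_)
  have : x ∈ S 1 := (hmem 1 x).2 (mem_aroots.1 hx).2
  rw [ha, ha0] at this
  exact Finset.mem_singleton.1 this

lemma Dfac_iterPoly_bounds [PerfectField K] {f G : K[X]} {h : ℕ} (hred : f = G ^ p ^ h)
    (hG : derivative G ≠ 0) (hd : 1 < G.natDegree) (hf : 0 < f.natDegree)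
    (hform : ¬ ∃ a : K, f = C a * X ^ f.natDegree) (n : ℕ) :
    G.natDegree ^ n ≤ G.natDegree ^ 2 * Dfac (iterPoly f n) ∧
      Dfac (iterPoly f n) ≤ G.natDegree ^ n := by
  have hup (n : ℕ) : Dfac (iterPoly f (n + 1)) ≤ G.natDegree * Dfac (iterPoly f n) := by
    simpa only [Dfac_eq_card_aroots (iterPoly_ne_zero hf _)] using
      (card_aroots_iterPoly_bounds hred hG hf n).1
  have hlow (n : ℕ) :
      G.natDegree * Dfac (iterPoly f n) ≤ Dfac (iterPoly f (n + 1)) + (G.natDegree - 1) := by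
    simp only [Dfac_eq_card_aroots (iterPoly_ne_zero hf _)]
    refine (card_aroots_iterPoly_bounds hred hG hf n).2.trans (Nat.add_le_add_left ?_ _)
    simpa only [natDegree_map] using sum_rootMultiplicity_derivative_le (G.map (algebraMap K (AlgebraicClosure K)))
      ((iterPoly f (n + 1)).aroots (AlgebraicClosure K)).toFinset
  have h2 : 1 < Dfac (iterPoly f 2) := by
    rw [Dfac_eq_card_aroots (iterPoly_ne_zero hf _)]
    exact one_lt_card_aroots_iterPoly_two hred hG hd hf hform
  have h0 : Dfac (iterPoly f 0) = 1 := by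
    rw [Dfac_eq_card_aroots (iterPoly_ne_zero hf _)]
    simp [iterPoly]
  have hgrow (n : ℕ) : G.natDegree ^ n + 1 ≤ Dfac (iterPoly f (n + 2)) := by
    induction n with
    | zero => rw [pow_zero]; exact h2
    | succ n ih =>
      have := hlow (n + 2)
      have h3 := Nat.mul_le_mul_left G.natDegree ih
      rw [mul_add, ← pow_succ', mul_one] at h3
      rw [show n + 1 + 2 = n + 2 + 1 from rfl]
      omega
  refine ⟨?_, ?_⟩
  · match n with
    | 0 => rw [h0]; simpa using Nat.one_le_pow _ _ (by omega)
    | 1 =>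
      have := hlow 0
      rw [h0] at this
      have h1 : 1 ≤ Dfac (iterPoly f 1) := by simp only [zero_add] at this; omega
      nlinarith
    | n + 2 =>
      rw [pow_add, mul_comm]
      exact Nat.mul_le_mul_left _ (by have := hgrow n; omega)
  · induction n with
    | zero => rw [h0, pow_zero]
    | succ n ih => rw [pow_succ']; exact (hup n).trans (Nat.mul_le_mul_left _ ih)

end Iterates

theorem stmt6 {K : Type*} [Field K] [Fintype K] {p : ℕ} [Fact p.Prime] [CharP K p]
    (f G : Polynomial K) (h D d : ℕ)
    (hfD : f.natDegree = D) (hD : 1 < D)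
    (hform1 : ¬ ∃ a : K, f = C a * X ^ D)
    (hform2 : ¬ ∃ (a b : K) (m : ℕ), f = C a * X ^ p ^ m + C b)
    (hred : f = G ^ p ^ h) (hG : derivative G ≠ 0)
    (hd : G.natDegree = d) (hd1 : 1 < d) :
    (∃ c₁ c₂ : ℝ, 0 < c₁ ∧ 0 < c₂ ∧ ∀ n : ℕ,
      c₁ * (d : ℝ) ^ n ≤ (Dfac (iterPoly f n) : ℝ) ∧
      (Dfac (iterPoly f n) : ℝ) ≤ c₂ * (d : ℝ) ^ n) ∧
    (∃ c : ℝ, 0 < c ∧ ∀ n : ℕ, c * (n : ℝ) ≤ (Mfac (iterPoly f n) : ℝ)) ∧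
    (∃ c : ℝ, 0 < c ∧ ∀ n : ℕ,
      c * Real.sqrt (d : ℝ) ^ n ≤ (Nfac (iterPoly f n) : ℝ) ∨
      c * Real.sqrt (d : ℝ) ^ n ≤ (Mfac (iterPoly f n) : ℝ)) := by
  subst hfD hd
  have hf : 0 < f.natDegree := by omega
  have hb := Dfac_iterPoly_bounds hred hG hd1 hf hform1
  have hdR : (0 : ℝ) < (G.natDegree : ℝ) := by exact_mod_cast (by omega : 0 < G.natDegree)
  have hlowR (n : ℕ) : ((G.natDegree : ℝ) ^ 2)⁻¹ * (G.natDegree : ℝ) ^ n ≤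
      (Dfac (iterPoly f n) : ℝ) := by
    rw [inv_mul_le_iff₀ (by positivity)]
    exact_mod_cast (hb n).1
  refine ⟨⟨((G.natDegree : ℝ) ^ 2)⁻¹, 1, by positivity, one_pos, fun n => ⟨hlowR n, ?_⟩⟩, ?_, ?_⟩
  · rw [one_mul]
    exact_mod_cast (hb n).2
  · obtain ⟨s, hs⟩ : ∃ s : ℕ, Fintype.card K ≤ 2 ^ s := ⟨_, Nat.lt_two_pow_self.le⟩
    set d := G.natDegree
    obtain ⟨t, ht⟩ : ∃ t : ℕ, d ^ 2 ≤ 2 ^ t := ⟨_, Nat.lt_two_pow_self.le⟩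
    refine ⟨((t + 2 * s + 1 : ℕ) : ℝ)⁻¹, by positivity, fun n => ?_⟩
    rw [inv_mul_le_iff₀ (by positivity)]
    set M := Mfac (iterPoly f n)
    have hprod := Dfac_le_Nfac_mul_Mfac (iterPoly f n)
    have hM : 1 ≤ M := by
      by_contra hM
      have hM0 : Mfac (iterPoly f n) = 0 := by omega
      have h1 := (hb n).1
      have : 0 < d ^ n := by positivity
      rw [hM0, mul_zero] at hprod
      rw [Nat.le_zero.1 hprod, mul_zero] at h1
      omega
    have hpow : 2 ^ n ≤ 2 ^ (t + (s * (M + 1) + M)) := calc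
      2 ^ n ≤ d ^ n := Nat.pow_le_pow_left hd1 n
      _ ≤ d ^ 2 * Dfac (iterPoly f n) := (hb n).1
      _ ≤ 2 ^ t * ((2 ^ s) ^ (M + 1) * 2 ^ M) := Nat.mul_le_mul ht (hprod.trans
          (Nat.mul_le_mul ((Nfac_le_pow_Mfac _).trans (Nat.pow_le_pow_left hs _))
            Nat.lt_two_pow_self.le))
      _ = _ := by rw [← pow_mul, ← pow_add, ← pow_add]
    have hn : n ≤ t + (s * (M + 1) + M) := (Nat.pow_le_pow_iff_right (by norm_num)).1 hpow
    have : n ≤ (t + 2 * s + 1) * M := by nlinarith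
    exact_mod_cast this
  · refine ⟨(G.natDegree : ℝ)⁻¹, by positivity, fun n => ?_⟩
    by_contra! hcon
    have hprod : (Dfac (iterPoly f n) : ℝ) ≤ Nfac (iterPoly f n) * Mfac (iterPoly f n) := by
      exact_mod_cast Dfac_le_Nfac_mul_Mfac (iterPoly f n)
    have hlt := mul_lt_mul'' hcon.1 hcon.2 (Nat.cast_nonneg _) (Nat.cast_nonneg _)
    have heq : (G.natDegree : ℝ)⁻¹ * √(G.natDegree : ℝ) ^ n *
        ((G.natDegree : ℝ)⁻¹ * √(G.natDegree : ℝ) ^ n) =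
        ((G.natDegree : ℝ) ^ 2)⁻¹ * (G.natDegree : ℝ) ^ n := by
      rw [mul_mul_mul_comm, ← mul_pow, Real.mul_self_sqrt hdR.le, ← mul_inv, ← pow_two]
    linarith [hlowR n]
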